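/- Let $k$ be an algebraically closed field of characteristic zero, $K$ a field extension of $k$, and let $u_1,u_2,v_1,v_2,w_1,w_2 \in K$ be algebraically independent over $k$. Define $t_{i,j,k} := (u_i+v_j)/(v_j+w_k)$. If $x \in K$ is algebraic over each of the four subfields $k(t_{1,1,1},t_{1,2,1})$, $k(t_{1,1,2},t_{1,2,2})$, $k(t_{2,1,1},t_{2,2,1})$, and $k(t_{2,1,2},t_{2,2,2})$, then $x$ is algebraic over $k$. -/

import Mathlib

/-- If every member of a finite algebraically independent family is algebraic over a family with
the same index type, then the second family is algebraically independent too. -/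
theorem AlgebraicIndependent.of_forall_isAlgebraic {F K ι : Type*} [Finite ι] [Field F]
    [Field K] [Algebra F K] {x y : ι → K} (hx : AlgebraicIndependent F x)
    (h : ∀ i, IsAlgebraic (Algebra.adjoin F (Set.range y)) (x i)) :
    AlgebraicIndependent F y := by
  have hle : Set.range x ⊆ (AlgebraicIndependent.matroid F K).closure (Set.range y) := by
    rw [AlgebraicIndependent.matroid_closure_eq]
    rintro _ ⟨i, rfl⟩
    exact h i
  have hrank : (Set.univ : Set ι).encard ≤ (AlgebraicIndependent.matroid F K).eRk (Set.range y) := by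
    have h1 := (AlgebraicIndependent.matroid F K).eRk_mono hle
    rw [Matroid.eRk_closure_eq,
      (AlgebraicIndependent.matroid_indep_iff.2 hx.coe_range).eRk_eq_encard,
      ← Set.image_univ, hx.injective.encard_image] at h1
    exact h1
  have hcard : (Set.range y).encard = (Set.univ : Set ι).encard :=
    le_antisymm (by rw [← Set.image_univ]; exact Set.encard_image_le ..)
      (hrank.trans (Matroid.eRk_le_encard ..))
  have hinj : Function.Injective y := by
    rw [← Set.injOn_univ]
    exact Set.finite_univ.injOn_of_encard_image_eq (by rwa [Set.image_univ])
  have hind : (AlgebraicIndependent.matroid F K).Indep (Set.range y) := by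
    rw [Matroid.indep_iff_eRk_eq_encard_of_finite (Set.finite_range y)]
    exact le_antisymm (Matroid.eRk_le_encard ..) (hcard.trans_le hrank)
  exact AlgebraicIndependent.of_subtype_range hinj hind

theorem AlgebraicIndependent.add_ne_zero {R A ι : Type*} [CommRing R] [CommRing A] [Nontrivial A]
    [Algebra R A] {x : ι → A} (hx : AlgebraicIndependent R x) {i j : ι} (hij : i ≠ j) :
    x i + x j ≠ 0 := by
  intro h
  refine hx.transcendental_adjoin (s := {j}) (i := i) hij ?_
  rw [eq_neg_of_add_eq_zero_left h]
  exact isAlgebraic_algebraMap (A := A) (-⟨x j, Algebra.subset_adjoin ⟨j, rfl, rfl⟩⟩ :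
    Algebra.adjoin R (x '' {j}))

/-- If `y` is algebraically independent over an intermediate field `F` of `K / k`, then an element
algebraic over both `F` and `k(y)` is algebraic over `k`. -/
theorem IntermediateField.isAlgebraic_of_isAlgebraic_of_algebraicIndependent {k K ι : Type*}
    [Field k] [Field K] [Algebra k K] (F : IntermediateField k K) {y : ι → K}
    (hy : AlgebraicIndependent F y) {x : K} (hF : IsAlgebraic F x)
    (hxy : IsAlgebraic (IntermediateField.adjoin k (Set.range y)) x) :
    IsAlgebraic k x := by
  by_contra hx
  have hx' : AlgebraicIndependent k (fun _ : Unit ↦ x) :=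
    algebraicIndependent_unique_type_iff.2 hx
  have : IsScalarTower k (algebraicClosure F K) K := .of_algebraMap_eq fun _ ↦ rfl
  have hs := hx'.sumElim_of_tower (S := algebraicClosure F K)
    (by rintro _ ⟨_, rfl⟩; exact ⟨⟨x, mem_algebraicClosure_iff.2 hF⟩, rfl⟩)
    (hy.extendScalars (algebraicClosure F K))
  rw [IntermediateField.isAlgebraic_adjoin_iff] at hxy
  refine hs.transcendental_adjoin (s := Set.range Sum.inl) (i := Sum.inr ()) (by simp) ?_
  rw [← Set.range_comp]
  exact hxy

/-- With `u₁,u₂,v₁,v₂,w₁,w₂ ∈ K` algebraically independent over the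
algebraically closed field `k` of characteristic zero and `t i j l = (uᵢ+vⱼ)/(vⱼ+wₗ)`,
any `x ∈ K` algebraic over each of the four subfields `k(tᵢ₁ₗ, tᵢ₂ₗ)` (the frame `𝓘₂`)
is algebraic over `k`. -/
theorem twisted_frame_two_base {k K : Type*} [Field k] [IsAlgClosed k] [CharZero k]
    [Field K] [Algebra k K] (u₁ u₂ v₁ v₂ w₁ w₂ : K)
    (hind : AlgebraicIndependent k ![u₁, u₂, v₁, v₂, w₁, w₂]) (x : K)
    (h11 : IsAlgebraic (IntermediateField.adjoin k
      {(u₁ + v₁) / (v₁ + w₁), (u₁ + v₂) / (v₂ + w₁)} : IntermediateField k K) x)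
    (h12 : IsAlgebraic (IntermediateField.adjoin k
      {(u₁ + v₁) / (v₁ + w₂), (u₁ + v₂) / (v₂ + w₂)} : IntermediateField k K) x)
    (h21 : IsAlgebraic (IntermediateField.adjoin k
      {(u₂ + v₁) / (v₁ + w₁), (u₂ + v₂) / (v₂ + w₁)} : IntermediateField k K) x)
    (h22 : IsAlgebraic (IntermediateField.adjoin k
      {(u₂ + v₁) / (v₁ + w₂), (u₂ + v₂) / (v₂ + w₂)} : IntermediateField k K) x) :
    IsAlgebraic k x := by
  set F : IntermediateField k K := IntermediateField.adjoin k {u₂, v₁, v₂, w₂}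
  have memF : ∀ z ∈ ({u₂, v₁, v₂, w₂} : Set K), z ∈ F := fun z hz ↦
    IntermediateField.subset_adjoin _ _ hz
  have huw : AlgebraicIndependent F ![u₁, w₁] := by
    rw [IntermediateField.algebraicIndependent_adjoin_iff]
    have h := hind.adjoin_of_disjoint (s := {1, 2, 3, 5}) (t := {0, 4}) (by simp)
    rw [show (![u₁, u₂, v₁, v₂, w₁, w₂] '' {1, 2, 3, 5} : Set K) = {u₂, v₁, v₂, w₂} by
      simp [Set.image_insert_eq]] at h
    have h' := h.comp ![⟨0, by simp⟩, ⟨4, by simp⟩] (by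
      intro i j; fin_cases i <;> fin_cases j <;> simp)
    convert h' using 1
    funext i
    fin_cases i <;> rfl
  have hne1 : v₁ + w₁ ≠ 0 := hind.add_ne_zero (i := 2) (j := 4) (by decide)
  have hne2 : v₂ + w₁ ≠ 0 := hind.add_ne_zero (i := 3) (j := 4) (by decide)
  have huw' : u₁ - w₁ ≠ 0 := sub_ne_zero.2 fun h ↦ by
    simpa using hind.injective (a₁ := 0) (a₂ := 4) h
  have hvv : v₁ - v₂ ≠ 0 := sub_ne_zero.2 fun h ↦ by
    simpa using hind.injective (a₁ := 2) (a₂ := 3) h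
  set a := (u₁ + v₁) / (v₁ + w₁) with ha
  set b := (u₁ + v₂) / (v₂ + w₁) with hb
  have hab : a - b ≠ 0 := by
    have : a - b = - ((u₁ - w₁) * (v₁ - v₂)) / ((v₁ + w₁) * (v₂ + w₁)) := by
      rw [ha, hb]; field_simp; ring
    rw [this]
    exact div_ne_zero (neg_ne_zero.2 (mul_ne_zero huw' hvv)) (mul_ne_zero hne1 hne2)
  have hind2 : AlgebraicIndependent F ![a, b] := by
    refine huw.of_forall_isAlgebraic ?_
    have key : ∀ z ∈ IntermediateField.adjoin F (Set.range ![a, b]),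
        IsAlgebraic (Algebra.adjoin F (Set.range ![a, b])) z := fun z hz ↦
      IntermediateField.isAlgebraic_adjoin_iff.1 (isAlgebraic_algebraMap (A := K)
        (⟨z, hz⟩ : IntermediateField.adjoin F (Set.range ![a, b])))
    set L := IntermediateField.adjoin F (Set.range ![a, b])
    have haL : a ∈ L := IntermediateField.subset_adjoin _ _ ⟨0, rfl⟩
    have hbL : b ∈ L := IntermediateField.subset_adjoin _ _ ⟨1, rfl⟩
    have hv1 : v₁ ∈ L := L.algebraMap_mem ⟨v₁, memF _ (by simp)⟩
    have hv2 : v₂ ∈ L := L.algebraMap_mem ⟨v₂, memF _ (by simp)⟩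
    have e1 : a * (v₁ + w₁) = u₁ + v₁ := div_mul_cancel₀ _ hne1
    have e2 : b * (v₂ + w₁) = u₁ + v₂ := div_mul_cancel₀ _ hne2
    have hw : w₁ ∈ L := by
      have : w₁ = (v₁ - v₂ - a * v₁ + b * v₂) / (a - b) := by
        rw [eq_div_iff hab]; linear_combination e1 - e2
      rw [this]
      exact div_mem (add_mem (sub_mem (sub_mem hv1 hv2) (mul_mem haL hv1)) (mul_mem hbL hv2))
        (sub_mem haL hbL)
    have hu : u₁ ∈ L := by
      rw [show u₁ = a * (v₁ + w₁) - v₁ by rw [e1]; ring]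
      exact sub_mem (mul_mem haL (add_mem hv1 hw)) hv1
    intro i
    fin_cases i
    · exact key _ hu
    · exact key _ hw
  refine F.isAlgebraic_of_isAlgebraic_of_algebraicIndependent hind2 ?_ ?_
  · have hle : IntermediateField.adjoin k
        {(u₂ + v₁) / (v₁ + w₂), (u₂ + v₂) / (v₂ + w₂)} ≤ F := by
      have h1 := memF u₂ (by simp)
      have h2 := memF v₁ (by simp)
      have h3 := memF v₂ (by simp)
      have h4 := memF w₂ (by simp)
      rw [IntermediateField.adjoin_le_iff]
      rintro _ (rfl | rfl)
      · exact div_mem (add_mem h1 h2) (add_mem h2 h4)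
      · exact div_mem (add_mem h1 h3) (add_mem h3 h4)
    let _ := (IntermediateField.inclusion hle).toRingHom.toAlgebra
    have : IsScalarTower (IntermediateField.adjoin k
        {(u₂ + v₁) / (v₁ + w₂), (u₂ + v₂) / (v₂ + w₂)}) F K := .of_algebraMap_eq fun _ ↦ rfl
    exact h22.tower_top F
  · rwa [Matrix.range_cons_cons_empty]
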